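/- Slice lemma for partial colorings: for every α ≥ 0 there exist constants 0 < η, τ < 1 such that for every convex body K ⊂ ℝⁿ with γ_n(K) > e^{−ηn}, there exist i ∈ [n] and ξ ∈ {−1, 1} with γ_{n−1}(K ∩ {x_i = αξ}) ≥ τ · γ_n(K). -/

import Mathlib

open MeasureTheory Real
open scoped RealInnerProductSpace Pointwise

/-- The standard Gaussian measure on `ℝⁿ`. -/
noncomputable def gauss (n : ℕ) : Measure (EuclideanSpace ℝ (Fin n)) :=
  volume.withDensity (fun x => ENNReal.ofReal ((2 * π) ^ (-(n : ℝ) / 2) * Real.exp (-‖x‖ ^ 2 / 2)))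

/-- The Gaussian mean-width `w(K) = E[sup_{x ∈ K} ⟨Γ, x⟩]` of a set `K ⊆ ℝⁿ`. -/
noncomputable def meanWidth (n : ℕ) (K : Set (EuclideanSpace ℝ (Fin n))) : ℝ :=
  ∫ g, sSup ((fun x => ⟪g, x⟫) '' K) ∂(gauss n)
lemma bm_compact {A B C : Set ℝ} (hA : IsCompact A) (hB : IsCompact B) (hA0 : A.Nonempty)
    (hB0 : B.Nonempty) (h : ∀ x ∈ A, ∀ y ∈ B, (x + y) / 2 ∈ C) :
    volume A + volume B ≤ 2 * volume C := by
  obtain ⟨a, ha, hamax⟩ := hA.exists_isMaxOn hA0 continuousOn_id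
  obtain ⟨b, hb, hbmin⟩ := hB.exists_isMinOn hB0 continuousOn_id
  have hamax : ∀ x ∈ A, x ≤ a := fun x hx => hamax hx
  have hbmin : ∀ x ∈ B, b ≤ x := fun x hx => hbmin hx
  have h1 : (fun x => x + b) '' A ∪ (fun y => a + y) '' B ⊆ (2:ℝ) • C := by
    rintro z (⟨x, hx, rfl⟩ | ⟨y, hy, rfl⟩)
    · exact Set.mem_smul_set.2 ⟨_, h x hx b hb, by simp only [smul_eq_mul]; ring⟩
    · exact Set.mem_smul_set.2 ⟨_, h a ha y hy, by simp only [smul_eq_mul]; ring⟩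
  have h2 : volume ((fun x => x + b) '' A ∪ (fun y => a + y) '' B)
      = volume A + volume B := by
    rw [measure_union₀]
    · simp
    · exact (hB.image (by fun_prop)).measurableSet.nullMeasurableSet
    · refine measure_mono_null (t := {a + b}) ?_ (by simp)
      rintro z ⟨⟨x, hx, rfl⟩, ⟨y, hy, hxy⟩⟩
      have := hamax x hx
      have := hbmin y hy
      simp only [Set.mem_singleton_iff] at *
      linarith
  have h3 := measure_mono (μ := volume) h1
  rw [h2, Measure.addHaar_smul] at h3
  simpa using h3

lemma bm_meas {A B C : Set ℝ} (hA : MeasurableSet A) (hB : MeasurableSet B) (hA0 : A.Nonempty)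
    (hB0 : B.Nonempty) (h : ∀ x ∈ A, ∀ y ∈ B, (x + y) / 2 ∈ C) :
    volume A + volume B ≤ 2 * volume C := by
  obtain ⟨a, ha⟩ := hA0
  obtain ⟨b, hb⟩ := hB0
  rw [hA.measure_eq_iSup_isCompact, hB.measure_eq_iSup_isCompact]
  simp only [iSup_and']
  refine ENNReal.biSup_add_biSup_le' ⟨∅, by simp⟩ ⟨∅, by simp⟩ ?_
  rintro K ⟨hKA, hK⟩ L ⟨hLB, hL⟩
  refine le_trans (add_le_add (measure_mono (Set.subset_insert a K))
    (measure_mono (Set.subset_insert b L))) ?_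
  refine bm_compact (hK.insert a) (hL.insert b) ⟨a, by simp⟩ ⟨b, by simp⟩ ?_
  intro x hx y hy
  exact h x (Set.insert_subset ha hKA hx) y (Set.insert_subset hb hLB hy)

lemma pl_norm {f g h : ℝ → ℝ} (hf : Measurable f) (hg : Measurable g) (hh : Measurable h)
    (hf0 : ∀ x, 0 ≤ f x) (hg0 : ∀ x, 0 ≤ g x) (hh0 : ∀ x, 0 ≤ h x)
    (hf1 : ∀ x, f x ≤ 1) (hg1 : ∀ x, g x ≤ 1)
    (hfs : ∀ t < 1, ∃ x, t < f x) (hgs : ∀ t < 1, ∃ x, t < g x)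
    (H : ∀ x y, f x * g y ≤ h ((x + y) / 2) ^ 2) :
    (∫⁻ x, ENNReal.ofReal (f x)) + (∫⁻ x, ENNReal.ofReal (g x)) ≤
      2 * ∫⁻ x, ENNReal.ofReal (h x) := by
  rw [lintegral_eq_lintegral_meas_lt _ (.of_forall hf0) hf.aemeasurable,
    lintegral_eq_lintegral_meas_lt _ (.of_forall hg0) hg.aemeasurable,
    lintegral_eq_lintegral_meas_lt _ (.of_forall hh0) hh.aemeasurable]
  rw [← lintegral_const_mul' _ _ (by simp), ← lintegral_add_left]
  · refine setLIntegral_mono' measurableSet_Ioi ?_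
    intro t ht
    have ht : 0 < t := ht
    by_cases ht1 : t < 1
    · refine bm_meas (measurableSet_lt measurable_const hf) (measurableSet_lt measurable_const hg)
        (hfs t ht1) (hgs t ht1) ?_
      intro x hx y hy
      simp only [Set.mem_ofPred_eq] at *
      have := H x y
      have h3 : t * t < f x * g y := mul_lt_mul'' hx hy ht.le ht.le
      exact lt_of_pow_lt_pow_left₀ 2 (hh0 _) (by nlinarith)
    · have e1 : {a | t < f a} = ∅ := by
        ext x; simp only [Set.mem_ofPred_eq, Set.mem_empty_iff_false, iff_false]
        have := hf1 x; linarith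
      have e2 : {a | t < g a} = ∅ := by
        ext x; simp only [Set.mem_ofPred_eq, Set.mem_empty_iff_false, iff_false]
        have := hg1 x; linarith
      simp [e1, e2]
  · refine Antitone.measurable ?_
    intro s t hst
    exact measure_mono fun x (hx : t < f x) => lt_of_le_of_lt hst hx

lemma ennreal_amgm {a b c : ENNReal} (h : a + b ≤ 2 * c) : a * b ≤ c ^ 2 := by
  by_cases hc : c = ⊤
  · simp [hc]
  have hab : a + b ≠ ⊤ := ne_top_of_le_ne_top (ENNReal.mul_ne_top (by simp) hc) h
  have ha : a ≠ ⊤ := fun h => hab (by simp [h])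
  have hb : b ≠ ⊤ := fun h => hab (by simp [h])
  lift a to NNReal using ha
  lift b to NNReal using hb
  lift c to NNReal using hc
  norm_cast at *
  have h : (a:ℝ) + b ≤ 2 * c := by exact_mod_cast h
  have : (a:ℝ) * b ≤ c ^ 2 := by
    nlinarith [sq_nonneg ((a:ℝ) - b), a.2, b.2, c.2, a.coe_nonneg, b.coe_nonneg]
  exact_mod_cast this

/-- bounded one-dimensional midpoint Prekopa-Leindler -/
lemma pl_bdd {f g : ℝ → ℝ} {h : ℝ → ENNReal} (hf : Measurable f) (hg : Measurable g)
    (hh : Measurable h)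
    (hf0 : ∀ x, 0 ≤ f x) (hg0 : ∀ x, 0 ≤ g x)
    (M : ℝ) (hfM : ∀ x, f x ≤ M) (hgM : ∀ x, g x ≤ M)
    (H : ∀ x y, ENNReal.ofReal (f x) * ENNReal.ofReal (g y) ≤ h ((x + y) / 2) ^ 2) :
    (∫⁻ x, ENNReal.ofReal (f x)) * (∫⁻ x, ENNReal.ofReal (g x)) ≤
      (∫⁻ x, h x) ^ 2 := by
  have bf : BddAbove (Set.range f) := ⟨M, by rintro _ ⟨x, rfl⟩; exact hfM x⟩
  have bg : BddAbove (Set.range g) := ⟨M, by rintro _ ⟨x, rfl⟩; exact hgM x⟩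
  set F := ⨆ x, f x with hF
  set G := ⨆ x, g x with hG
  have hfF : ∀ x, f x ≤ F := le_ciSup bf
  have hgG : ∀ x, g x ≤ G := le_ciSup bg
  have hF0 : 0 ≤ F := (hf0 0).trans (hfF 0)
  have hG0 : 0 ≤ G := (hg0 0).trans (hgG 0)
  rcases hF0.eq_or_lt with hF0 | hF0
  · have : ∀ x, ENNReal.ofReal (f x) = 0 := fun x => by
      rw [ENNReal.ofReal_eq_zero, hF0]; exact hfF x
    simp [this]
  rcases hG0.eq_or_lt with hG0 | hG0
  · have : ∀ x, ENNReal.ofReal (g x) = 0 := fun x => by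
      rw [ENNReal.ofReal_eq_zero, hG0]; exact hgG x
    simp [this]
  set k := √(F * G) with hk
  have hk0 : 0 < k := Real.sqrt_pos.2 (by positivity)
  have hk2 : k ^ 2 = F * G := Real.sq_sqrt (by positivity)
  let h' : ℝ → ℝ := fun x => (min (h x) (ENNReal.ofReal k)).toReal / k
  have h'h : ∀ x, ENNReal.ofReal (k * h' x) ≤ h x := by
    intro x
    have : k * h' x = (min (h x) (ENNReal.ofReal k)).toReal := by simp only [h']; field_simp
    rw [this, ENNReal.ofReal_toReal (by simp)]
    exact min_le_left _ _
  have hn := pl_norm (f := fun x => f x / F) (g := fun x => g x / G) (h := h')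
    (by fun_prop) (by fun_prop) (by simp only [h']; fun_prop)
    (fun x => div_nonneg (hf0 x) hF0.le) (fun x => div_nonneg (hg0 x) hG0.le)
    (fun x => by positivity)
    (fun x => (div_le_one hF0).2 (hfF x)) (fun x => (div_le_one hG0).2 (hgG x))
    (fun t ht => by
      obtain ⟨x, hx⟩ := exists_lt_of_lt_ciSup (f := f) (b := t * F) (by rw [← hF]; nlinarith)
      exact ⟨x, (lt_div_iff₀ hF0).2 hx⟩)
    (fun t ht => by
      obtain ⟨x, hx⟩ := exists_lt_of_lt_ciSup (f := g) (b := t * G) (by rw [← hG]; nlinarith)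
      exact ⟨x, (lt_div_iff₀ hG0).2 hx⟩)
    (fun x y => by
      have e : f x / F * (g y / G) = (f x * g y) / k ^ 2 := by rw [hk2]; field_simp
      simp only [h', div_pow, e]
      gcongr
      rcases min_cases (h ((x+y)/2)) (ENNReal.ofReal k) with ⟨e, h1⟩ | ⟨e, h1⟩
      · rw [e]
        have := ENNReal.toReal_mono (ENNReal.pow_ne_top (ne_top_of_le_ne_top ENNReal.ofReal_ne_top h1)) (H x y)
        simpa [hf0, hg0] using this
      · rw [e, ENNReal.toReal_ofReal hk0.le, hk2]
        exact mul_le_mul (hfF x) (hgG y) (hg0 y) hF0.le)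
  have hn := ennreal_amgm hn
  have e1 : ∫⁻ x, ENNReal.ofReal (f x) = ENNReal.ofReal F * ∫⁻ x, ENNReal.ofReal (f x / F) := by
    rw [← lintegral_const_mul' _ _ (by simp)]
    congr 1; ext x
    rw [← ENNReal.ofReal_mul hF0.le]; congr 1; field_simp
  have e2 : ∫⁻ x, ENNReal.ofReal (g x) = ENNReal.ofReal G * ∫⁻ x, ENNReal.ofReal (g x / G) := by
    rw [← lintegral_const_mul' _ _ (by simp)]
    congr 1; ext x
    rw [← ENNReal.ofReal_mul hG0.le]; congr 1; field_simp
  have e3 : ENNReal.ofReal k * ∫⁻ x, ENNReal.ofReal (h' x) ≤ ∫⁻ x, h x := by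
    rw [← lintegral_const_mul' _ _ (by simp)]
    refine lintegral_mono fun x => ?_
    rw [← ENNReal.ofReal_mul hk0.le]
    exact h'h x
  calc _ = ENNReal.ofReal F * ENNReal.ofReal G * ((∫⁻ x, ENNReal.ofReal (f x / F)) *
        ∫⁻ x, ENNReal.ofReal (g x / G)) := by rw [e1, e2]; ring
    _ ≤ ENNReal.ofReal F * ENNReal.ofReal G * (∫⁻ x, ENNReal.ofReal (h' x)) ^ 2 := by gcongr
    _ = (ENNReal.ofReal k * ∫⁻ x, ENNReal.ofReal (h' x)) ^ 2 := by
        rw [mul_pow, ← ENNReal.ofReal_mul hF0.le, ← hk2, ENNReal.ofReal_pow hk0.le]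
    _ ≤ _ := by gcongr

lemma pl_trunc {f : ℝ → ENNReal} (hf : Measurable f) :
    ∫⁻ x, f x = ⨆ N : ℕ, ∫⁻ x, min (f x) N := by
  rw [← lintegral_iSup (fun N => by fun_prop)]
  · congr 1; ext x
    rw [← inf_iSup_eq]
    simp [ENNReal.iSup_natCast]
  · intro N M hNM x
    dsimp only
    gcongr

lemma pl_one {f g h : ℝ → ENNReal} (hf : Measurable f) (hg : Measurable g)
    (hh : Measurable h) (H : ∀ x y, f x * g y ≤ h ((x + y) / 2) ^ 2) :
    (∫⁻ x, f x) * (∫⁻ x, g x) ≤ (∫⁻ x, h x) ^ 2 := by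
  rw [pl_trunc hf, pl_trunc hg, ENNReal.iSup_mul]
  refine iSup_le fun N => ?_
  rw [ENNReal.mul_iSup]
  refine iSup_le fun M => ?_
  have key := pl_bdd (f := fun x => (min (f x) N).toReal) (g := fun x => (min (g x) M).toReal)
    (h := h) (by fun_prop) (by fun_prop) hh (fun x => by positivity) (fun x => by positivity)
    (max N M)
    (fun x => by
      have := ENNReal.toReal_mono (b := N) (by simp) (min_le_right (f x) N)
      simp only [ENNReal.toReal_natCast] at this
      exact this.trans (le_max_left _ _))
    (fun x => by
      have := ENNReal.toReal_mono (b := M) (by simp) (min_le_right (g x) M)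
      simp only [ENNReal.toReal_natCast] at this
      exact this.trans (le_max_right _ _))
    (fun x y => by
      rw [ENNReal.ofReal_toReal (by simp), ENNReal.ofReal_toReal (by simp)]
      exact (mul_le_mul' (min_le_left _ _) (min_le_left _ _)).trans (H x y))
  simpa [ENNReal.ofReal_toReal] using key

lemma lint_succ {n : ℕ} {f : (Fin (n+1) → ℝ) → ENNReal} (hf : Measurable f) :
    ∫⁻ x, f x = ∫⁻ t : ℝ, ∫⁻ y : Fin n → ℝ, f (Fin.cons t y) := by
  rw [← (volume_preserving_piFinSuccAbove (fun _ : Fin (n + 1) => ℝ) 0).symm.lintegral_comp hf]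
  rw [Measure.volume_eq_prod, lintegral_prod]
  · simp [MeasurableEquiv.piFinSuccAbove, Fin.insertNthEquiv]
  · exact (hf.comp (MeasurableEquiv.measurable _)).aemeasurable

lemma meas_cons (n : ℕ) : Measurable (fun p : ℝ × (Fin n → ℝ) => (Fin.cons p.1 p.2 : Fin (n+1) → ℝ)) := by
  refine measurable_pi_lambda _ fun i => ?_
  refine Fin.cases ?_ (fun j => ?_) i
  · simpa using measurable_fst
  · simp only [Fin.cons_succ]; fun_prop

lemma pl_n (n : ℕ) : ∀ {f g h : (Fin n → ℝ) → ENNReal} (_ : Measurable f) (_ : Measurable g)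
    (_ : Measurable h) (_ : ∀ x y, f x * g y ≤ h ((2:ℝ)⁻¹ • (x + y)) ^ 2),
    (∫⁻ x, f x) * (∫⁻ x, g x) ≤ (∫⁻ x, h x) ^ 2 := by
  induction n with
  | zero =>
    intro f g h hf hg hh H
    rw [Measure.volume_pi_eq_dirac 0, lintegral_dirac, lintegral_dirac, lintegral_dirac]
    simpa using H 0 0
  | succ n ih =>
    intro f g h hf hg hh H
    rw [lint_succ hf, lint_succ hg, lint_succ hh]
    have m : ∀ {f : (Fin (n+1) → ℝ) → ENNReal}, Measurable f →
        Measurable fun t : ℝ => ∫⁻ y : Fin n → ℝ, f (Fin.cons t y) := fun hf =>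
      Measurable.lintegral_prod_right' (f := fun p : ℝ × (Fin n → ℝ) => _) (hf.comp (meas_cons n))
    have m2 : ∀ {f : (Fin (n+1) → ℝ) → ENNReal}, Measurable f → ∀ t : ℝ,
        Measurable fun y : Fin n → ℝ => f (Fin.cons t y) := fun hf t =>
      (hf.comp (meas_cons n)).comp measurable_prodMk_left
    refine pl_one (m hf) (m hg) (m hh) fun s t => ?_
    refine ih (m2 hf s) (m2 hg t) (m2 hh _) fun x y => ?_
    convert H (Fin.cons s x) (Fin.cons t y) using 3
    ext i
    refine Fin.cases ?_ (fun j => ?_) i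
    · simp; ring
    · simp; ring

lemma gauss_lint {n : ℕ} {F : EuclideanSpace ℝ (Fin n) → ENNReal} (hF : Measurable F) :
    ∫⁻ x, F x ∂(gauss n) = ∫⁻ x : Fin n → ℝ,
      ENNReal.ofReal ((2 * π) ^ (-(n : ℝ) / 2) * Real.exp (-‖(WithLp.toLp 2 x : EuclideanSpace ℝ (Fin n))‖ ^ 2 / 2)) *
        F (WithLp.toLp 2 x) := by
  rw [gauss, lintegral_withDensity_eq_lintegral_mul _ (by fun_prop) hF]
  rw [← (PiLp.volume_preserving_toLp (Fin n)).lintegral_comp]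
  · rfl
  · exact Measurable.mul (by fun_prop) hF

lemma gauss_mid {n : ℕ} {A B C : Set (EuclideanSpace ℝ (Fin n))} (hA : MeasurableSet A)
    (hB : MeasurableSet B) (hC : MeasurableSet C)
    (h : ∀ x ∈ A, ∀ y ∈ B, (2:ℝ)⁻¹ • (x + y) ∈ C) :
    gauss n A * gauss n B ≤ gauss n C ^ 2 := by
  have e : ∀ {S : Set (EuclideanSpace ℝ (Fin n))}, MeasurableSet S →
      gauss n S = ∫⁻ x, S.indicator 1 x ∂(gauss n) := fun hS => by
    rw [lintegral_indicator_one hS]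
  have m : ∀ {S : Set (EuclideanSpace ℝ (Fin n))}, MeasurableSet S →
      Measurable (S.indicator (1 : EuclideanSpace ℝ (Fin n) → ENNReal)) :=
    fun hS => measurable_one.indicator hS
  have m' : ∀ {S : Set (EuclideanSpace ℝ (Fin n))}, MeasurableSet S →
      Measurable fun x : Fin n → ℝ => ENNReal.ofReal ((2 * π) ^ (-(n : ℝ) / 2) * Real.exp (-‖(WithLp.toLp 2 x : EuclideanSpace ℝ (Fin n))‖ ^ 2 / 2)) *
        S.indicator (1 : EuclideanSpace ℝ (Fin n) → ENNReal) (WithLp.toLp 2 x) := fun hS =>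
    Measurable.mul (by fun_prop) ((m hS).comp (by fun_prop))
  rw [e hA, e hB, e hC, gauss_lint (m hA), gauss_lint (m hB), gauss_lint (m hC)]
  refine pl_n n (m' hA) (m' hB) (m' hC) fun x y => ?_
  by_cases hx : WithLp.toLp 2 x ∈ A
  swap
  · simp [hx]
  by_cases hy : WithLp.toLp 2 y ∈ B
  swap
  · simp [hy]
  have hxy := h _ hx _ hy
  rw [← WithLp.toLp_add, ← WithLp.toLp_smul] at hxy
  rw [Set.indicator_of_mem hx, Set.indicator_of_mem hy, Set.indicator_of_mem hxy]
  simp only [Pi.one_apply, mul_one]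
  rw [← ENNReal.ofReal_mul (by positivity), ← ENNReal.ofReal_pow (by positivity)]
  apply ENNReal.ofReal_le_ofReal
  rw [WithLp.toLp_smul, WithLp.toLp_add]
  generalize (WithLp.toLp 2 x : EuclideanSpace ℝ (Fin n)) = u
  generalize (WithLp.toLp 2 y : EuclideanSpace ℝ (Fin n)) = v
  have hp := parallelogram_law_with_norm ℝ u v
  rw [mul_pow, mul_mul_mul_comm, ← Real.exp_add, ← Real.exp_nat_mul, ← sq]
  gcongr
  rw [norm_smul, mul_pow]
  simp only [norm_inv, Real.norm_ofNat]
  push_cast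
  nlinarith [sq_nonneg ‖u - v‖]

lemma slab_meas {n : ℕ} (i : Fin n) {B : Set ℝ} (hB : MeasurableSet B) :
    MeasurableSet {x : EuclideanSpace ℝ (Fin n) | x i ∈ B} := by
  have : Measurable fun x : EuclideanSpace ℝ (Fin n) => x i := by fun_prop
  exact this hB

/-- quasi-concavity at midpoints -/
lemma mid_qc {n : ℕ} {K : Set (EuclideanSpace ℝ (Fin n))} (hK : Convex ℝ K) (hKm : MeasurableSet K)
    (hK0 : gauss n K ≠ 0) (hKf : gauss n K ≠ ⊤) (i : Fin n) {f : ℝ → ℝ} (hf : Continuous f)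
    (hfi : ∀ B : Set ℝ, MeasurableSet B →
      ∫ x in B, f x = (gauss n (K ∩ {x | x i ∈ B}) / gauss n K).toReal)
    {a b m : ℝ} (ha : m ≤ f a) (hb : m ≤ f b) : m ≤ f ((a + b) / 2) := by
  by_contra! hc
  set c := (a + b) / 2 with hcdef
  obtain ⟨m2, hm2, hm2'⟩ := exists_between hc
  obtain ⟨m1, hm1, hm1'⟩ := exists_between hm2
  have Ea : ∀ᶠ t in nhds a, m2 < f t := hf.continuousAt.eventually (lt_mem_nhds (by linarith))
  have Eb : ∀ᶠ t in nhds b, m2 < f t := hf.continuousAt.eventually (lt_mem_nhds (by linarith))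
  have Ec : ∀ᶠ t in nhds c, f t < m1 := hf.continuousAt.eventually (gt_mem_nhds hm1)
  obtain ⟨ra, hra, Ha⟩ := Metric.eventually_nhds_iff.1 Ea
  obtain ⟨rb, hrb, Hb⟩ := Metric.eventually_nhds_iff.1 Eb
  obtain ⟨rc, hrc, Hc⟩ := Metric.eventually_nhds_iff.1 Ec
  set r := min ra (min rb rc)
  have hr : 0 < r := by positivity
  have I : ∀ t, IntegrableOn f (Set.Ioo (t - r) (t + r)) := fun t =>
    (hf.integrableOn_Icc (a := t - r) (b := t + r)).mono_set Set.Ioo_subset_Icc_self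
  have vol : ∀ t s : ℝ, ∫ _ in Set.Ioo (t - r) (t + r), s = 2 * r * s := fun t s => by
    rw [setIntegral_const, measureReal_def, Real.volume_Ioo, ENNReal.toReal_ofReal (by linarith)]
    simp; left; ring
  have C : ∀ t s : ℝ, IntegrableOn (fun _ => s) (Set.Ioo (t - r) (t + r)) volume := fun t s =>
    integrableOn_const (by simp)
  have La : 2 * r * m2 ≤ ∫ x in Set.Ioo (a - r) (a + r), f x := by
    rw [← vol a]
    refine setIntegral_mono_on (C _ _) (I _) measurableSet_Ioo fun x hx => (Ha ?_).le
    rw [Real.dist_eq, abs_lt]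
    have : r ≤ ra := min_le_left _ _
    constructor <;> linarith [hx.1, hx.2]
  have Lb : 2 * r * m2 ≤ ∫ x in Set.Ioo (b - r) (b + r), f x := by
    rw [← vol b]
    refine setIntegral_mono_on (C _ _) (I _) measurableSet_Ioo fun x hx => (Hb ?_).le
    rw [Real.dist_eq, abs_lt]
    have : r ≤ rb := (min_le_right _ _).trans (min_le_left _ _)
    constructor <;> linarith [hx.1, hx.2]
  have Lc : ∫ x in Set.Ioo (c - r) (c + r), f x ≤ 2 * r * m1 := by
    rw [← vol c]
    refine setIntegral_mono_on (I _) (C _ _) measurableSet_Ioo fun x hx => (Hc ?_).le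
    rw [Real.dist_eq, abs_lt]
    have : r ≤ rc := (min_le_right _ _).trans (min_le_right _ _)
    constructor <;> linarith [hx.1, hx.2]
  rw [hfi _ measurableSet_Ioo, ENNReal.toReal_div] at La Lb Lc
  have ms : ∀ t, MeasurableSet (K ∩ {x | x i ∈ Set.Ioo (t - r) (t + r)}) := fun t =>
    hKm.inter (slab_meas i measurableSet_Ioo)
  have key := gauss_mid (ms a) (ms b) (ms c) (by
    rintro x ⟨hx, hx'⟩ y ⟨hy, hy'⟩
    refine ⟨?_, ?_⟩
    · rw [smul_add]
      exact hK hx hy (by norm_num) (by norm_num) (by norm_num)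
    · simp only [Set.mem_ofPred_eq, Set.mem_Ioo, PiLp.smul_apply, PiLp.add_apply, smul_eq_mul] at *
      constructor <;> linarith [hx'.1, hx'.2, hy'.1, hy'.2])
  have fin : ∀ t, gauss n (K ∩ {x | x i ∈ Set.Ioo (t - r) (t + r)}) ≠ ⊤ := fun t =>
    ne_top_of_le_ne_top hKf (measure_mono Set.inter_subset_left)
  have key := ENNReal.toReal_mono (ENNReal.pow_ne_top (fin c)) key
  rw [ENNReal.toReal_mul, ENNReal.toReal_pow] at key
  have hk : 0 < (gauss n K).toReal := ENNReal.toReal_pos hK0 hKf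
  rw [le_div_iff₀ hk] at La Lb
  rw [div_le_iff₀ hk] at Lc
  generalize (gauss n (K ∩ {x | x i ∈ Set.Ioo (a - r) (a + r)})).toReal = P at *
  generalize (gauss n (K ∩ {x | x i ∈ Set.Ioo (b - r) (b + r)})).toReal = Q at *
  have hR0 : 0 ≤ (gauss n (K ∩ {x | x i ∈ Set.Ioo (c - r) (c + r)})).toReal := by positivity
  generalize (gauss n (K ∩ {x | x i ∈ Set.Ioo (c - r) (c + r)})).toReal = R at *
  have h1 : R < 2 * r * m2 * (gauss n K).toReal := by
    refine Lc.trans_lt ?_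
    gcongr
  have h2 : R ^ 2 < P * Q := by
    rw [sq]
    exact mul_lt_mul'' (h1.trans_le La) (h1.trans_le Lb) hR0 hR0
  linarith

lemma qc_side {f : ℝ → ℝ} (hf : Continuous f)
    (hmid : ∀ a b m : ℝ, m ≤ f a → m ≤ f b → m ≤ f ((a + b) / 2)) (α : ℝ) :
    (∀ x, α < x → f x ≤ f α) ∨ (∀ x, x < α → f x ≤ f α) := by
  by_contra! hcon
  obtain ⟨⟨b, hb, hfb⟩, a, ha, hfa⟩ := hcon
  set m := min (f a) (f b)
  have hm : f α < m := lt_min hfa hfb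
  have cl : IsClosed {t | m ≤ f t} := isClosed_le continuous_const hf
  obtain ⟨a', ha', hamax⟩ := ((isCompact_Icc (a := a) (b := α)).inter_right cl).exists_isMaxOn
    ⟨a, ⟨le_rfl, ha.le⟩, show m ≤ f a from min_le_left _ _⟩ continuousOn_id
  obtain ⟨b', hb', hbmin⟩ := ((isCompact_Icc (a := α) (b := b)).inter_right cl).exists_isMinOn
    ⟨b, ⟨hb.le, le_rfl⟩, show m ≤ f b from min_le_right _ _⟩ continuousOn_id
  have hA : m ≤ f a' := ha'.2
  have hB : m ≤ f b' := hb'.2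
  have hc := hmid a' b' m hA hB
  have ha1 : a' < α := lt_of_le_of_ne ha'.1.2 (by rintro rfl; linarith)
  have hb1 : α < b' := lt_of_le_of_ne hb'.1.1 (by rintro rfl; linarith)
  rcases le_total ((a' + b') / 2) α with h | h
  · have := hamax (show (a' + b') / 2 ∈ _ from ⟨⟨by linarith [ha'.1.1], h⟩, hc⟩)
    simp only [id, Set.mem_ofPred_eq] at this
    linarith
  · have := hbmin (show (a' + b') / 2 ∈ _ from ⟨⟨h, by linarith [hb'.1.2]⟩, hc⟩)
    simp only [id, Set.mem_ofPred_eq] at this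
    linarith

/-- product integrals against the Gaussian measure -/
lemma gauss_prod {n : ℕ} (u : Fin n → ℝ → ℝ) :
    ∫ x, ∏ i, u i (x i) ∂(gauss n) =
      ∏ i, ∫ t, ProbabilityTheory.gaussianPDFReal 0 1 t * u i t := by
  rw [gauss, integral_withDensity_eq_integral_toReal_smul (by fun_prop) (by simp)]
  rw [← integral_fintype_prod_volume_eq_prod,
    ← (PiLp.volume_preserving_toLp (Fin n)).integral_comp
      (MeasurableEquiv.toLp 2 (Fin n → ℝ)).measurableEmbedding]
  congr 1; ext x
  rw [Finset.prod_mul_distrib, smul_eq_mul, ENNReal.toReal_ofReal (by positivity)]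
  congr 1
  simp only [ProbabilityTheory.gaussianPDFReal, Finset.prod_mul_distrib, ← Real.exp_sum]
  congr 1
  · simp only [NNReal.coe_one, mul_one, Finset.prod_const, Finset.card_univ, Fintype.card_fin]
    rw [Real.sqrt_eq_rpow, ← Real.rpow_neg (by positivity), ← Real.rpow_natCast, ← Real.rpow_mul (by positivity)]
    congr 1; ring
  · rw [EuclideanSpace.norm_sq_eq, ← Finset.sum_div, Finset.sum_neg_distrib]
    simp

instance gauss_prob (n : ℕ) : IsProbabilityMeasure (gauss n) := by
  have h := gauss_prod (n := n) (fun _ _ => 1)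
  simp only [Finset.prod_const_one, mul_one,
    ProbabilityTheory.integral_gaussianPDFReal_eq_one 0 one_ne_zero] at h
  rw [integral_const, smul_eq_mul, mul_one, measureReal_def, ENNReal.toReal_eq_one_iff] at h
  exact ⟨h⟩

lemma ind_exp (B : Set ℝ) (t : ℝ) :
    Real.exp (-B.indicator 1 t) = 1 - (1 - Real.exp (-1)) * B.indicator 1 t := by
  by_cases h : t ∈ B <;> simp [h]

lemma q_lt {a b : ℝ} (hab : a < b) :
    ∫ t, ProbabilityTheory.gaussianPDFReal 0 1 t * Real.exp (-(Set.Ioo a b).indicator 1 t) < 1 := by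
  have I := ProbabilityTheory.integrable_gaussianPDFReal 0 1
  have e : ∀ t, ProbabilityTheory.gaussianPDFReal 0 1 t * Real.exp (-(Set.Ioo a b).indicator 1 t) =
      ProbabilityTheory.gaussianPDFReal 0 1 t - (1 - Real.exp (-1)) *
        (Set.Ioo a b).indicator (ProbabilityTheory.gaussianPDFReal 0 1) t := by
    intro t
    rw [ind_exp]
    by_cases h : t ∈ Set.Ioo a b
    · simp only [h, Set.indicator_of_mem, Pi.one_apply]; ring
    · simp only [h, Set.indicator_of_notMem, not_false_eq_true]; ring
  simp only [e]
  rw [integral_sub I ((I.indicator measurableSet_Ioo).const_mul _), integral_const_mul,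
    integral_indicator measurableSet_Ioo,
    ProbabilityTheory.integral_gaussianPDFReal_eq_one 0 one_ne_zero]
  have h1 : 0 < 1 - Real.exp (-1) := by
    have : Real.exp (-1) < 1 := by rw [← Real.exp_zero]; exact Real.exp_lt_exp.2 (by norm_num)
    linarith
  have h2 : 0 < ∫ t in Set.Ioo a b, ProbabilityTheory.gaussianPDFReal 0 1 t := by
    rw [setIntegral_pos_iff_support_of_nonneg_ae]
    · have : Function.support (ProbabilityTheory.gaussianPDFReal 0 1) = Set.univ := by
        ext t
        simp [(ProbabilityTheory.gaussianPDFReal_pos 0 1 t one_ne_zero).ne']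
      rw [this, Set.univ_inter, Real.volume_Ioo]
      simpa using hab
    · exact .of_forall fun t => ProbabilityTheory.gaussianPDFReal_nonneg 0 1 t
    · exact I.integrableOn
  nlinarith [mul_pos h1 h2]

lemma main_bound {n : ℕ} {K : Set (EuclideanSpace ℝ (Fin n))} (hKm : MeasurableSet K)
    {B : Fin n → Set ℝ} (hB : ∀ i, MeasurableSet (B i)) {q τ : ℝ}
    (hq : ∀ i, ∫ t, ProbabilityTheory.gaussianPDFReal 0 1 t * Real.exp (-(B i).indicator 1 t) ≤ q)
    (hτ : ∀ i, (gauss n (K ∩ {x | x i ∈ B i})).toReal ≤ τ * (gauss n K).toReal) :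
    (gauss n K).toReal ≤ (q * Real.exp τ) ^ n := by
  have mi : ∀ i, Measurable fun x : EuclideanSpace ℝ (Fin n) => (B i).indicator (1 : ℝ → ℝ) (x i) :=
    fun i => (measurable_one.indicator (hB i)).comp (by fun_prop)
  have i0 : ∀ i (x : EuclideanSpace ℝ (Fin n)), 0 ≤ (B i).indicator (1 : ℝ → ℝ) (x i) := fun i x =>
    Set.indicator_nonneg (by simp) _
  have i1 : ∀ i (x : EuclideanSpace ℝ (Fin n)), (B i).indicator (1 : ℝ → ℝ) (x i) ≤ 1 := fun i x =>
    Set.indicator_le_self' (by simp) _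
  set N : EuclideanSpace ℝ (Fin n) → ℝ := fun x => ∑ i, (B i).indicator (1 : ℝ → ℝ) (x i) with hN
  have Ii : ∀ i, Integrable (fun x : EuclideanSpace ℝ (Fin n) => (B i).indicator (1 : ℝ → ℝ) (x i))
      (gauss n) := fun i => by
    refine Integrable.of_bound (mi i).aestronglyMeasurable 1 (.of_forall fun x => ?_)
    rw [Real.norm_of_nonneg (i0 i x)]; exact i1 i x
  have IN : Integrable N (gauss n) := integrable_finsetSum _ fun i _ => Ii i
  have N0 : ∀ x, 0 ≤ N x := fun x => Finset.sum_nonneg fun i _ => i0 i x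
  have Ie : Integrable (fun x => Real.exp (-N x)) (gauss n) := by
    refine Integrable.of_bound (by have := IN.aestronglyMeasurable; fun_prop) 1 (.of_forall fun x => ?_)
    rw [Real.norm_of_nonneg (by positivity)]
    exact Real.exp_le_one_iff.2 (by linarith [N0 x])
  have s1 : ∫ x, Real.exp (-N x) ∂(gauss n) ≤ q ^ n := by
    have : ∀ x, Real.exp (-N x) = ∏ i, Real.exp (-(B i).indicator 1 (x i)) := fun x => by
      rw [← Real.exp_sum, Finset.sum_neg_distrib]
    simp only [this]
    rw [gauss_prod (fun i t => Real.exp (-(B i).indicator 1 t))]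
    calc _ ≤ ∏ i : Fin n, q := Finset.prod_le_prod (fun i _ => integral_nonneg fun t =>
            mul_nonneg (ProbabilityTheory.gaussianPDFReal_nonneg 0 1 t) (by positivity)) fun i _ => hq i
      _ = q ^ n := by simp
  have s2 : ∫ x in K, Real.exp (-N x) ∂(gauss n) ≤ ∫ x, Real.exp (-N x) ∂(gauss n) :=
    setIntegral_le_integral Ie (.of_forall fun x => by positivity)
  have s3 : ∫ x in K, Real.exp (-(n * τ)) * (1 + n * τ - N x) ∂(gauss n) ≤
      ∫ x in K, Real.exp (-N x) ∂(gauss n) := by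
    refine integral_mono (((integrable_const _).sub IN).const_mul _).integrableOn Ie.integrableOn fun x => ?_
    have h := Real.add_one_le_exp (n * τ - N x)
    have e : Real.exp (-N x) = Real.exp (-(n * τ)) * Real.exp (n * τ - N x) := by
      rw [← Real.exp_add]; congr 1; ring
    simp only [e]
    gcongr
    linarith
  have s4 : ∫ x in K, N x ∂(gauss n) ≤ n * (τ * (gauss n K).toReal) := by
    rw [hN, integral_finsetSum _ fun i _ => (Ii i).integrableOn]
    calc _ ≤ ∑ i : Fin n, τ * (gauss n K).toReal := by
          refine Finset.sum_le_sum fun i _ => le_trans (le_of_eq ?_) (hτ i)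
          have : (fun x : EuclideanSpace ℝ (Fin n) => (B i).indicator (1 : ℝ → ℝ) (x i)) =
            {x : EuclideanSpace ℝ (Fin n) | x i ∈ B i}.indicator 1 := by
            ext x; simp [Set.indicator]
          rw [this, integral_indicator_one (slab_meas i (hB i)), measureReal_def,
            Measure.restrict_apply (slab_meas i (hB i)), Set.inter_comm]
      _ = _ := by simp
  rw [integral_const_mul, integral_sub (integrable_const _).integrableOn IN.integrableOn,
    setIntegral_const, smul_eq_mul, measureReal_def] at s3
  have s5 : Real.exp (-(n * τ)) * (gauss n K).toReal ≤ q ^ n := by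
    refine le_trans ?_ (s3.trans (s2.trans s1))
    gcongr
    nlinarith
  rw [mul_pow, ← Real.exp_nat_mul]
  calc (gauss n K).toReal = (Real.exp (-(n * τ)) * (gauss n K).toReal) * Real.exp (n * τ) := by
        rw [mul_right_comm, ← Real.exp_add]; simp
    _ ≤ _ := by gcongr

theorem stmt17 (α : ℝ) (hα : 0 ≤ α) :
    ∃ η τ : ℝ, 0 < η ∧ η < 1 ∧ 0 < τ ∧ τ < 1 ∧
      ∀ (n : ℕ) (K : Set (EuclideanSpace ℝ (Fin n))),
        Convex ℝ K → IsCompact K → (interior K).Nonempty →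
        ENNReal.ofReal (Real.exp (-η * n)) < gauss n K →
        -- `f i` is the density of the `i`-th coordinate marginal of `γ_K`, so that
        -- `γ_{n-1}(K ∩ {x_i = c}) = γ_n(K) · f i c`:
        ∀ f : Fin n → ℝ → ℝ, (∀ i, Continuous (f i)) →
          (∀ (i : Fin n) (B : Set ℝ), MeasurableSet B →
            ∫ x in B, f i x = (gauss n (K ∩ {x | x i ∈ B}) / gauss n K).toReal) →
          ∃ (i : Fin n) (ξ : ℝ), (ξ = 1 ∨ ξ = -1) ∧
            τ * (gauss n K).toReal ≤ (gauss n K).toReal * f i (α * ξ) := by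
  set q1 := ∫ t, ProbabilityTheory.gaussianPDFReal 0 1 t *
    Real.exp (-(Set.Ioo α (α + 1)).indicator 1 t) with hq1
  set q2 := ∫ t, ProbabilityTheory.gaussianPDFReal 0 1 t *
    Real.exp (-(Set.Ioo (α - 1) α).indicator 1 t) with hq2
  have h1 : q1 < 1 := q_lt (by linarith)
  have h2 : q2 < 1 := q_lt (by linarith)
  obtain ⟨q, hq, hqlt⟩ : ∃ q, max (max q1 q2) 0 < q ∧ q < 1 :=
    exists_between (max_lt (max_lt h1 h2) one_pos)
  have hq1q : q1 ≤ q := (le_max_left _ _).trans ((le_max_left _ _).trans hq.le)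
  have hq2q : q2 ≤ q := (le_max_right _ _).trans ((le_max_left _ _).trans hq.le)
  have hq0 : 0 < q := (le_max_right _ _).trans_lt hq
  have hL : 0 < -Real.log q := by linarith [Real.log_neg hq0 hqlt]
  obtain ⟨η, hη0, hη⟩ : ∃ η : ℝ, 0 < η ∧ η < min (-Real.log q / 2) 1 :=
    exists_between (by positivity)
  have hηL : η < -Real.log q / 2 := hη.trans_le (min_le_left _ _)
  have hη1 : η < 1 := hη.trans_le (min_le_right _ _)
  refine ⟨η, η, hη0, hη1, hη0, hη1, ?_⟩
  intro n K hK hKc _ hbig f hf hfi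
  have hKm : MeasurableSet K := hKc.measurableSet
  have hK0 : gauss n K ≠ 0 := (lt_of_le_of_lt (zero_le) hbig).ne'
  have hKf : gauss n K ≠ ⊤ := measure_ne_top _ _
  have hKpos : 0 < (gauss n K).toReal := ENNReal.toReal_pos hK0 hKf
  by_contra! hcon
  have hfα : ∀ i, f i α < η := by
    intro i
    have h := hcon i 1 (Or.inl rfl)
    rw [mul_one, mul_comm] at h
    exact lt_of_mul_lt_mul_right h hKpos.le
  -- on one side of `α`, the density is at most `η`
  have hside : ∀ i, ∃ c : ℝ, (∀ x ∈ Set.Ioo c (c + 1), f i x ≤ η) ∧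
      ∫ t, ProbabilityTheory.gaussianPDFReal 0 1 t *
        Real.exp (-(Set.Ioo c (c + 1)).indicator 1 t) ≤ q := by
    intro i
    rcases qc_side (hf i) (fun a b m ha hb => mid_qc hK hKm hK0 hKf i (hf i) (hfi i) ha hb) α with
      h | h
    · exact ⟨α, fun x hx => (h x hx.1).trans (hfα i).le, hq1q⟩
    · refine ⟨α - 1, fun x hx => (h x (by linarith [hx.2])).trans (hfα i).le, ?_⟩
      rw [sub_add_cancel]
      exact hq2q
  choose c hc1 hc2 using hside
  have hmain := main_bound hKm (B := fun i => Set.Ioo (c i) (c i + 1)) (q := q) (τ := η)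
    (fun i => measurableSet_Ioo) hc2 (fun i => by
      have h := hfi i (Set.Ioo (c i) (c i + 1)) measurableSet_Ioo
      rw [ENNReal.toReal_div] at h
      rw [← div_le_iff₀ hKpos, ← h]
      calc ∫ x in Set.Ioo (c i) (c i + 1), f i x
          ≤ ∫ x in Set.Ioo (c i) (c i + 1), η :=
            setIntegral_mono_on
              (((hf i).integrableOn_Icc (a := c i) (b := c i + 1)).mono_set
                Set.Ioo_subset_Icc_self)
              (integrableOn_const (by simp)) measurableSet_Ioo (hc1 i)
        _ = η := by
            rw [setIntegral_const, measureReal_def, Real.volume_Ioo]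
            simp)
  have hlow : Real.exp (-η * n) < (gauss n K).toReal :=
    (ENNReal.ofReal_lt_iff_lt_toReal (Real.exp_pos _).le hKf).1 hbig
  have hup : (q * Real.exp η) ^ n ≤ Real.exp (-η * n) := by
    have e : Real.exp (-η * n) = Real.exp (-η) ^ n := by
      rw [← Real.exp_nat_mul]; congr 1; ring
    rw [e]
    gcongr
    calc q * Real.exp η = Real.exp (Real.log q + η) := by
          rw [Real.exp_add, Real.exp_log hq0]
      _ ≤ Real.exp (-η) := Real.exp_le_exp.2 (by linarith)
  linarith
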